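/- arXiv:0812.0464 — 11 statements merged into one kernel-verified Lean document; each statement's English description precedes it below -/
import Mathlib

section
/- (Perturbation Lemma, full form.) Given a contraction of (M, d_M) onto (N, d_N) and a small perturbation δ of d_M, the tuple (ι̃, p̃, h̃) is a contraction of (M, d_M + δ) onto (N, d_N + δ̃); that is: (N, d_N + δ̃) is a differential graded module, ι̃ and p̃ are chain maps with respect to the differentials d_M + δ and d_N + δ̃, p̃ ∘ ι̃ = id_N, ι̃ ∘ p̃ − id_M = h̃ ∘ (d_M + δ) + (d_M + δ) ∘ h̃, and h̃ ∘ h̃ = h̃ ∘ ι̃ = p̃ ∘ h̃ = 0. -/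
namespace BVHPT

variable {R M N : Type*} [CommRing R] [AddCommGroup M] [Module R M]
  [AddCommGroup N] [Module R N]

/-- A differential graded module over `R`: an internally ℤ-graded `R`-module together with
a square-zero differential of degree `+1`. -/
structure DGModule (R M : Type*) [CommRing R] [AddCommGroup M] [Module R M] where
  grading : ℤ → Submodule R M
  internal : DirectSum.IsInternal grading
  d : M →ₗ[R] M
  d_deg : ∀ i : ℤ, ∀ x ∈ grading i, d x ∈ grading (i + 1)
  d_sq : d ∘ₗ d = 0

/-- A contraction of `(M, d_M)` onto `(N, d_N)`. -/
structure Contraction (𝓜 : DGModule R M) (𝓝 : DGModule R N) where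
  ι : N →ₗ[R] M
  p : M →ₗ[R] N
  h : M →ₗ[R] M
  ι_deg : ∀ i : ℤ, ∀ x ∈ 𝓝.grading i, ι x ∈ 𝓜.grading i
  p_deg : ∀ i : ℤ, ∀ x ∈ 𝓜.grading i, p x ∈ 𝓝.grading i
  h_deg : ∀ i : ℤ, ∀ x ∈ 𝓜.grading i, h x ∈ 𝓜.grading (i - 1)
  chain_ι : 𝓜.d ∘ₗ ι = ι ∘ₗ 𝓝.d
  chain_p : 𝓝.d ∘ₗ p = p ∘ₗ 𝓜.d
  p_ι : p ∘ₗ ι = LinearMap.id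
  homotopy : ι ∘ₗ p - LinearMap.id = h ∘ₗ 𝓜.d + 𝓜.d ∘ₗ h
  h_h : h ∘ₗ h = 0
  h_ι : h ∘ₗ ι = 0
  p_h : p ∘ₗ h = 0

/-- A perturbation of the differential `d_M`: a degree `+1` map `δ` with `(d_M + δ)² = 0`. -/
structure Perturbation (𝓜 : DGModule R M) where
  δ : M →ₗ[R] M
  δ_deg : ∀ i : ℤ, ∀ x ∈ 𝓜.grading i, δ x ∈ 𝓜.grading (i + 1)
  sq : (𝓜.d + δ) ∘ₗ (𝓜.d + δ) = 0

/-- The perturbation `δ` is small w.r.t. the contraction: `(h ∘ δ)ⁿ x = 0` for `n` large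
(pointwise). -/
def IsSmall {𝓜 : DGModule R M} {𝓝 : DGModule R N} (C : Contraction 𝓜 𝓝)
    (P : Perturbation 𝓜) : Prop :=
  ∀ x : M, ∃ n : ℕ, ((C.h ∘ₗ P.δ) ^ n) x = 0

/-- The perturbed maps `ι̃ = Σ (hδ)ⁿ ι`, `p̃ = Σ p (δh)ⁿ`, `h̃ = Σ (hδ)ⁿ h` and
`δ̃ = Σ p δ (hδ)ⁿ ι`, characterized by their (pointwise finite) partial sums. -/
structure PerturbedMaps {𝓜 : DGModule R M} {𝓝 : DGModule R N} (C : Contraction 𝓜 𝓝)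
    (P : Perturbation 𝓜) where
  ιT : N →ₗ[R] M
  pT : M →ₗ[R] N
  hT : M →ₗ[R] M
  δT : N →ₗ[R] N
  ιT_spec : ∀ (x : N) (k : ℕ), ((C.h ∘ₗ P.δ) ^ k) (C.ι x) = 0 →
    ιT x = ∑ n ∈ Finset.range k, ((C.h ∘ₗ P.δ) ^ n) (C.ι x)
  pT_spec : ∀ (x : M) (k : ℕ), ((P.δ ∘ₗ C.h) ^ k) x = 0 →
    pT x = ∑ n ∈ Finset.range k, C.p (((P.δ ∘ₗ C.h) ^ n) x)
  hT_spec : ∀ (x : M) (k : ℕ), ((C.h ∘ₗ P.δ) ^ k) (C.h x) = 0 →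
    hT x = ∑ n ∈ Finset.range k, ((C.h ∘ₗ P.δ) ^ n) (C.h x)
  δT_spec : ∀ (x : N) (k : ℕ), ((C.h ∘ₗ P.δ) ^ k) (C.ι x) = 0 →
    δT x = ∑ n ∈ Finset.range k, C.p (P.δ (((C.h ∘ₗ P.δ) ^ n) (C.ι x)))


/-- If `φ` is locally nilpotent, then `1 - φ` is invertible, with inverse given by the
pointwise finite geometric series. -/
theorem exists_geom_series (φ : M →ₗ[R] M) (hφ : ∀ x, ∃ n : ℕ, (φ ^ n) x = 0) :
    ∃ S : M →ₗ[R] M, (∀ x, S x = x + φ (S x)) ∧ (∀ x, S x = x + S (φ x)) ∧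
      ∀ (x : M) (k : ℕ), (φ ^ k) x = 0 → S x = ∑ n ∈ Finset.range k, (φ ^ n) x := by
  have inv (x : M) (k : ℕ) (hk : (φ ^ k) x = 0) :
      (1 - φ : M →ₗ[R] M) (∑ n ∈ Finset.range k, (φ ^ n) x) = x := by
    have := LinearMap.congr_fun (mul_neg_geom_sum φ k) x
    simpa [hk] using this
  have inj : Function.Injective (1 - φ : M →ₗ[R] M) := by
    refine (injective_iff_map_eq_zero _).2 fun x hx => ?_
    have hfix : φ x = x := (sub_eq_zero.1 (by simpa using hx)).symm
    obtain ⟨n, hn⟩ := hφ x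
    have : (φ ^ n) x = x := by
      rw [Module.End.pow_apply]
      exact Function.iterate_fixed hfix n
    exact this.symm.trans hn
  have surj : Function.Surjective (1 - φ : M →ₗ[R] M) := fun x =>
    let ⟨k, hk⟩ := hφ x
    ⟨_, inv x k hk⟩
  let e := LinearEquiv.ofBijective (1 - φ : M →ₗ[R] M) ⟨inj, surj⟩
  have right (x : M) : (1 - φ : M →ₗ[R] M) (e.symm x) = x := e.apply_symm_apply x
  refine ⟨e.symm.toLinearMap, fun x => ?_, fun x => ?_, fun x k hk => ?_⟩
  · have := right x
    simp only [LinearMap.sub_apply, Module.End.one_apply] at this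
    exact sub_eq_iff_eq_add.1 this
  · have : e.symm ((1 - φ : M →ₗ[R] M) x) = x := e.symm_apply_apply x
    simp only [LinearMap.sub_apply, Module.End.one_apply, map_sub] at this
    exact sub_eq_iff_eq_add.1 this
  · exact inj ((right x).trans (inv x k hk).symm)

theorem comp_pow_succ_apply (f g : M →ₗ[R] M) (n : ℕ) (x : M) :
    ((f ∘ₗ g) ^ (n + 1)) x = f (((g ∘ₗ f) ^ n) (g x)) := by
  induction n with
  | zero => simp
  | succ n ih =>
    rw [pow_succ', Module.End.mul_apply, ih, pow_succ', Module.End.mul_apply]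
    rfl

theorem comp_pow_mem {𝓜 : DGModule R M} {f g : M →ₗ[R] M} {a b : ℤ} (hab : a + b = 0)
    (hf : ∀ i : ℤ, ∀ x ∈ 𝓜.grading i, f x ∈ 𝓜.grading (i + a))
    (hg : ∀ i : ℤ, ∀ x ∈ 𝓜.grading i, g x ∈ 𝓜.grading (i + b))
    (n : ℕ) {i : ℤ} {x : M} (hx : x ∈ 𝓜.grading i) :
    ((f ∘ₗ g) ^ n) x ∈ 𝓜.grading i := by
  induction n with
  | zero => simpa using hx
  | succ n ih =>
    rw [pow_succ', Module.End.mul_apply]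
    have := hf _ _ (hg _ _ ih)
    rwa [show i + b + a = i by lia] at this

/-- The perturbed maps are expressed through a single operator `A = ∑ δ (hδ)ⁿ`. -/
theorem PerturbedMaps.exists_operator {𝓜 : DGModule R M} {𝓝 : DGModule R N}
    {C : Contraction 𝓜 𝓝} {P : Perturbation 𝓜} (hsmall : IsSmall C P)
    (T : PerturbedMaps C P) :
    ∃ A : M →ₗ[R] M, (∀ x, A x = P.δ x + P.δ (C.h (A x))) ∧
      (∀ x, A x = P.δ x + A (C.h (P.δ x))) ∧
      (∀ x, T.ιT x = C.ι x + C.h (A (C.ι x))) ∧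
      (∀ x, T.pT x = C.p x + C.p (A (C.h x))) ∧
      (∀ x, T.hT x = C.h x + C.h (A (C.h x))) ∧
      (∀ x, T.δT x = C.p (A (C.ι x))) := by
  obtain ⟨S, left, right, series⟩ := exists_geom_series _ hsmall
  simp only [LinearMap.comp_apply] at left right
  refine ⟨P.δ ∘ₗ S, fun x => ?_, fun x => ?_, fun x => ?_, fun x => ?_, fun x => ?_,
    fun x => ?_⟩
  · simpa using congrArg P.δ (left x)
  · simpa using congrArg P.δ (right x)
  · obtain ⟨k, hk⟩ := hsmall (C.ι x)
    rw [T.ιT_spec x k hk, ← series _ k hk]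
    exact left _
  · obtain ⟨k, hk⟩ := hsmall (C.h x)
    have hk' : ((P.δ ∘ₗ C.h) ^ (k + 1)) x = 0 := by
      rw [comp_pow_succ_apply, hk, map_zero]
    rw [T.pT_spec x _ hk', Finset.sum_range_succ']
    simp only [comp_pow_succ_apply, LinearMap.comp_apply]
    rw [← map_sum, ← map_sum, ← series _ k hk, add_comm]
    simp
  · obtain ⟨k, hk⟩ := hsmall (C.h x)
    rw [T.hT_spec x k hk, ← series _ k hk]
    exact left _
  · obtain ⟨k, hk⟩ := hsmall (C.ι x)
    rw [T.δT_spec x k hk, ← map_sum, ← map_sum, ← series _ k hk]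
    rfl

theorem Contraction.ι_p_apply {𝓜 : DGModule R M} {𝓝 : DGModule R N} (C : Contraction 𝓜 𝓝)
    (x : M) : C.ι (C.p x) = x + C.h (𝓜.d x) + 𝓜.d (C.h x) := by
  have := LinearMap.congr_fun C.homotopy x
  simp only [LinearMap.sub_apply, LinearMap.add_apply, LinearMap.comp_apply,
    LinearMap.id_apply] at this
  rw [sub_eq_iff_eq_add.1 this]
  abel

theorem Perturbation.sq_apply {𝓜 : DGModule R M} (P : Perturbation 𝓜) (x : M) :
    𝓜.d (P.δ x) + P.δ (𝓜.d x) + P.δ (P.δ x) = 0 := by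
  have h₁ := LinearMap.congr_fun P.sq x
  have h₂ := LinearMap.congr_fun 𝓜.d_sq x
  simp only [LinearMap.add_apply, LinearMap.comp_apply, LinearMap.zero_apply, map_add] at h₁ h₂
  linear_combination (norm := module) h₁ - h₂

/-- The Maurer–Cartan type identity `A ι p A + A d + d A = 0`. -/
theorem Contraction.operator_identity {𝓜 : DGModule R M} {𝓝 : DGModule R N}
    (C : Contraction 𝓜 𝓝) (P : Perturbation 𝓜) {A : M →ₗ[R] M}
    (hl : ∀ x, A x = P.δ x + P.δ (C.h (A x))) (hr : ∀ x, A x = P.δ x + A (C.h (P.δ x)))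
    (x : M) : A (C.ι (C.p (A x))) + A (𝓜.d x) + 𝓜.d (A x) = 0 := by
  obtain ⟨y, hy⟩ : ∃ y, y = x + C.h (A x) := ⟨_, rfl⟩
  have hA : A x = P.δ y := by rw [hy, map_add, ← hl]
  have hdy : 𝓜.d y = 𝓜.d x + 𝓜.d (C.h (P.δ y)) := by rw [← hA, hy, map_add]
  have e₁ := P.sq_apply y
  have e₂ := congrArg (fun z => A (C.h z)) e₁
  have e₃ := hr (P.δ y)
  have e₄ := hr (𝓜.d y)
  have e₅ := congrArg A hdy
  rw [C.ι_p_apply, hA]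
  simp only [map_add, map_zero] at e₂ e₅ ⊢
  linear_combination (norm := module) e₁ + e₂ + e₃ + e₄ - e₅

/-- **Perturbation Lemma (full form).** Given a contraction of `(M, d_M)` onto `(N, d_N)`
and a small perturbation `δ` of `d_M`, the tuple `(ι̃, p̃, h̃)` is a contraction of
`(M, d_M + δ)` onto `(N, d_N + δ̃)`. -/
theorem perturbation_lemma {𝓜 : DGModule R M} {𝓝 : DGModule R N}
    (C : Contraction 𝓜 𝓝) (P : Perturbation 𝓜)
    (hsmall : IsSmall C P) (T : PerturbedMaps C P) :
    -- (N, d_N + δ̃) is a differential graded module: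
    (∀ i : ℤ, ∀ x ∈ 𝓝.grading i, T.δT x ∈ 𝓝.grading (i + 1)) ∧
    ((𝓝.d + T.δT) ∘ₗ (𝓝.d + T.δT) = 0) ∧
    -- the perturbed maps have the correct degrees:
    (∀ i : ℤ, ∀ x ∈ 𝓝.grading i, T.ιT x ∈ 𝓜.grading i) ∧
    (∀ i : ℤ, ∀ x ∈ 𝓜.grading i, T.pT x ∈ 𝓝.grading i) ∧
    (∀ i : ℤ, ∀ x ∈ 𝓜.grading i, T.hT x ∈ 𝓜.grading (i - 1)) ∧
    -- ι̃ and p̃ are chain maps for the perturbed differentials: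
    ((𝓜.d + P.δ) ∘ₗ T.ιT = T.ιT ∘ₗ (𝓝.d + T.δT)) ∧
    ((𝓝.d + T.δT) ∘ₗ T.pT = T.pT ∘ₗ (𝓜.d + P.δ)) ∧
    -- p̃ ∘ ι̃ = id and the homotopy relation:
    (T.pT ∘ₗ T.ιT = LinearMap.id) ∧
    (T.ιT ∘ₗ T.pT - LinearMap.id = T.hT ∘ₗ (𝓜.d + P.δ) + (𝓜.d + P.δ) ∘ₗ T.hT) ∧
    -- side conditions:
    (T.hT ∘ₗ T.hT = 0) ∧ (T.hT ∘ₗ T.ιT = 0) ∧ (T.pT ∘ₗ T.hT = 0) := by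
  obtain ⟨A, hl, hr, hι, hp, hh, hδ⟩ := T.exists_operator hsmall
  have key := C.operator_identity P hl hr
  have chain_ι (x : N) : 𝓜.d (C.ι x) = C.ι (𝓝.d x) := LinearMap.congr_fun C.chain_ι x
  have chain_p (x : M) : 𝓝.d (C.p x) = C.p (𝓜.d x) := LinearMap.congr_fun C.chain_p x
  have p_ι (x : N) : C.p (C.ι x) = x := LinearMap.congr_fun C.p_ι x
  have h_h (x : M) : C.h (C.h x) = 0 := LinearMap.congr_fun C.h_h x
  have h_ι (x : N) : C.h (C.ι x) = 0 := LinearMap.congr_fun C.h_ι x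
  have p_h (x : M) : C.p (C.h x) = 0 := LinearMap.congr_fun C.p_h x
  have d_sq (x : N) : 𝓝.d (𝓝.d x) = 0 := LinearMap.congr_fun 𝓝.d_sq x
  have hδ_mem (n : ℕ) {i : ℤ} {x : M} (hx : x ∈ 𝓜.grading i) :
      ((C.h ∘ₗ P.δ) ^ n) x ∈ 𝓜.grading i :=
    comp_pow_mem (a := -1) (b := 1) (by simp) C.h_deg P.δ_deg n hx
  have δh_mem (n : ℕ) {i : ℤ} {x : M} (hx : x ∈ 𝓜.grading i) :
      ((P.δ ∘ₗ C.h) ^ n) x ∈ 𝓜.grading i :=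
    comp_pow_mem (a := 1) (b := -1) (by simp) P.δ_deg C.h_deg n hx
  refine ⟨fun i x hx => ?_, ?_, fun i x hx => ?_, fun i x hx => ?_, fun i x hx => ?_,
    ?_, ?_, ?_, ?_, ?_, ?_, ?_⟩
  · obtain ⟨k, hk⟩ := hsmall (C.ι x)
    rw [T.δT_spec x k hk]
    exact Submodule.sum_mem _ fun n _ =>
      C.p_deg _ _ (P.δ_deg _ _ (hδ_mem n (C.ι_deg _ _ hx)))
  · ext x
    have e := congrArg C.p (key (C.ι x))
    simp only [LinearMap.comp_apply, LinearMap.add_apply, LinearMap.zero_apply, hδ, map_add,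
      map_zero, chain_ι, chain_p, d_sq] at e ⊢
    linear_combination (norm := module) e
  · obtain ⟨k, hk⟩ := hsmall (C.ι x)
    rw [T.ιT_spec x k hk]
    exact Submodule.sum_mem _ fun n _ => hδ_mem n (C.ι_deg _ _ hx)
  · obtain ⟨k, hk⟩ := hsmall (C.h x)
    rw [T.pT_spec x (k + 1) (by rw [comp_pow_succ_apply, hk, map_zero])]
    exact Submodule.sum_mem _ fun n _ => C.p_deg _ _ (δh_mem n hx)
  · obtain ⟨k, hk⟩ := hsmall (C.h x)
    rw [T.hT_spec x k hk]
    exact Submodule.sum_mem _ fun n _ => hδ_mem n (C.h_deg _ _ hx)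
  · ext x
    have e₁ := congrArg C.h (key (C.ι x))
    have e₂ := C.ι_p_apply (A (C.ι x))
    have e₃ := hl (C.ι x)
    simp only [LinearMap.comp_apply, LinearMap.add_apply, hι, hδ, map_add, map_zero,
      chain_ι] at e₁ e₂ e₃ ⊢
    linear_combination (norm := module) -e₁ - e₂ - e₃
  · ext x
    have e₁ := congrArg C.p (key (C.h x))
    have e₂ := congrArg (fun z => C.p (A z)) (C.ι_p_apply x)
    have e₃ := congrArg C.p (hr x)
    simp only [LinearMap.comp_apply, LinearMap.add_apply, hp, hδ, map_add, map_zero,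
      chain_p] at e₁ e₂ e₃ ⊢
    linear_combination (norm := module) e₁ + e₂ + e₃
  · ext x
    simp [hp, hι, p_ι, h_h, h_ι, p_h]
  · ext x
    have e₁ := congrArg C.h (key (C.h x))
    have e₂ := congrArg (fun z => C.h (A z)) (C.ι_p_apply x)
    have e₃ := C.ι_p_apply (A (C.h x))
    have e₄ := C.ι_p_apply x
    have e₅ := congrArg C.h (hr x)
    have e₆ := hl (C.h x)
    simp only [LinearMap.comp_apply, LinearMap.add_apply, LinearMap.sub_apply,
      LinearMap.id_apply, hp, hι, hh, map_add, map_zero] at e₁ e₂ e₃ e₄ e₅ e₆ ⊢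
    linear_combination (norm := module) e₁ + e₂ + e₃ + e₄ + e₅ + e₆
  · ext x
    simp [hh, h_h]
  · ext x
    simp [hh, hι, h_h, h_ι]
  · ext x
    simp [hp, hh, h_h, p_h]

end BVHPT
end

section
/- Given a contraction of (M, d_M) onto (N, d_N) and a small perturbation δ of d_M, the perturbed inclusion ι̃ is a chain map from (N, d_N + δ̃) to (M, d_M + δ): (d_M + δ) ∘ ι̃ = ι̃ ∘ (d_N + δ̃). -/
namespace BVHPT

variable {R M N : Type*} [CommRing R] [AddCommGroup M] [Module R M]
  [AddCommGroup N] [Module R N]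

theorem PerturbedMaps.ιT_apply {𝓜 : DGModule R M} {𝓝 : DGModule R N} {C : Contraction 𝓜 𝓝}
    {P : Perturbation 𝓜} (hsmall : IsSmall C P) (T : PerturbedMaps C P) (x : N) :
    T.ιT x = C.ι x + C.h (P.δ (T.ιT x)) := by
  obtain ⟨k, hk⟩ := hsmall (C.ι x)
  have hk' : ((C.h ∘ₗ P.δ) ^ (k + 1)) (C.ι x) = 0 := by
    rw [pow_succ', Module.End.mul_apply, hk, map_zero]
  conv_lhs => rw [T.ιT_spec x (k + 1) hk', Finset.sum_range_succ']
  rw [T.ιT_spec x k hk, map_sum, map_sum, add_comm]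
  simp [pow_succ']

theorem PerturbedMaps.δT_apply {𝓜 : DGModule R M} {𝓝 : DGModule R N} {C : Contraction 𝓜 𝓝}
    {P : Perturbation 𝓜} (hsmall : IsSmall C P) (T : PerturbedMaps C P) (x : N) :
    T.δT x = C.p (P.δ (T.ιT x)) := by
  obtain ⟨k, hk⟩ := hsmall (C.ι x)
  rw [T.ιT_spec x k hk, T.δT_spec x k hk, map_sum, map_sum]

theorem IsSmall.eq_zero_of_fixed {𝓜 : DGModule R M} {𝓝 : DGModule R N} {C : Contraction 𝓜 𝓝}
    {P : Perturbation 𝓜} (hsmall : IsSmall C P) {z : M} (hz : C.h (P.δ z) = z) : z = 0 := by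
  obtain ⟨k, hk⟩ := hsmall z
  rwa [Module.End.pow_apply, Function.iterate_fixed (f := C.h ∘ₗ P.δ) hz] at hk

/-- Given a contraction of `(M, d_M)` onto `(N, d_N)` and a small perturbation `δ` of `d_M`,
the perturbed inclusion `ι̃` is a chain map from `(N, d_N + δ̃)` to `(M, d_M + δ)`. -/
theorem perturbed_inclusion_chain_map {𝓜 : DGModule R M} {𝓝 : DGModule R N}
    (C : Contraction 𝓜 𝓝) (P : Perturbation 𝓜)
    (hsmall : IsSmall C P) (T : PerturbedMaps C P) :
    (𝓜.d + P.δ) ∘ₗ T.ιT = T.ιT ∘ₗ (𝓝.d + T.δT) := by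
  ext x
  have hy := T.ιT_apply hsmall x
  have hw := T.ιT_apply hsmall ((𝓝.d + T.δT) x)
  have hδ := T.δT_apply hsmall x
  simp only [LinearMap.comp_apply]
  set y := T.ιT x
  have h_y : C.h y = 0 := by
    rw [hy, map_add]
    simpa using congrArg₂ (· + ·) (LinearMap.congr_fun C.h_ι x)
      (LinearMap.congr_fun C.h_h (P.δ y))
  have p_y : C.p y = x := by
    rw [hy, map_add]
    simpa using congrArg₂ (· + ·) (LinearMap.congr_fun C.p_ι x)
      (LinearMap.congr_fun C.p_h (P.δ y))
  have hom_y : C.ι x - y = C.h (𝓜.d y) := by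
    simpa [h_y, p_y] using LinearMap.congr_fun C.homotopy y
  have h_Dy : C.h ((𝓜.d + P.δ) y) = 0 := by
    rw [LinearMap.add_apply, map_add, ← hom_y, sub_add_eq_add_sub, ← hy, sub_self]
  have p_Dy : C.p ((𝓜.d + P.δ) y) = (𝓝.d + T.δT) x := by
    have hc : 𝓝.d (C.p y) = C.p (𝓜.d y) := LinearMap.congr_fun C.chain_p y
    rw [LinearMap.add_apply, LinearMap.add_apply, map_add, hδ, ← hc, p_y]
  have sq_y : 𝓜.d ((𝓜.d + P.δ) y) + P.δ ((𝓜.d + P.δ) y) = 0 :=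
    LinearMap.congr_fun P.sq y
  have hom_Dy : C.ι ((𝓝.d + T.δT) x) - (𝓜.d + P.δ) y = C.h (𝓜.d ((𝓜.d + P.δ) y)) := by
    have hh : C.ι (C.p ((𝓜.d + P.δ) y)) - (𝓜.d + P.δ) y =
        C.h (𝓜.d ((𝓜.d + P.δ) y)) + 𝓜.d (C.h ((𝓜.d + P.δ) y)) :=
      LinearMap.congr_fun C.homotopy ((𝓜.d + P.δ) y)
    rwa [h_Dy, p_Dy, map_zero, add_zero] at hh
  rw [← sub_eq_zero]
  apply hsmall.eq_zero_of_fixed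
  rw [eq_neg_of_add_eq_zero_left sq_y, map_neg] at hom_Dy
  rw [map_sub, map_sub, eq_sub_of_add_eq' hw.symm, ← neg_eq_iff_eq_neg.mpr hom_Dy]
  abel

end BVHPT
end

section
/- Given a contraction of (M, d_M) onto (N, d_N) and a small perturbation δ of d_M, the perturbed differential on N squares to zero: (d_N + δ̃) ∘ (d_N + δ̃) = 0, so that (N, d_N + δ̃) is again a differential graded module. -/
namespace BVHPT

variable {R M N : Type*} [CommRing R] [AddCommGroup M] [Module R M]
  [AddCommGroup N] [Module R N]

namespace PerturbedMaps

variable {𝓜 : DGModule R M} {𝓝 : DGModule R N} {C : Contraction 𝓜 𝓝} {P : Perturbation 𝓜}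

theorem ιT_apply_s4 (T : PerturbedMaps C P) (hsmall : IsSmall C P) (x : N) :
    T.ιT x = C.ι x + C.h (P.δ (T.ιT x)) := by
  obtain ⟨k, hk⟩ := hsmall (C.ι x)
  have hk' : ((C.h ∘ₗ P.δ) ^ (k + 1)) (C.ι x) = 0 := by
    rw [pow_succ', Module.End.mul_apply, hk, map_zero]
  conv_lhs => rw [T.ιT_spec x (k + 1) hk']
  rw [T.ιT_spec x k hk, Finset.sum_range_succ', add_comm, map_sum, map_sum]
  simp [pow_succ', Module.End.mul_apply]

theorem δT_apply_s4 (T : PerturbedMaps C P) (hsmall : IsSmall C P) (x : N) :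
    T.δT x = C.p (P.δ (T.ιT x)) := by
  obtain ⟨k, hk⟩ := hsmall (C.ι x)
  rw [T.δT_spec x k hk, T.ιT_spec x k hk, map_sum, map_sum]

theorem p_ιT_apply (T : PerturbedMaps C P) (hsmall : IsSmall C P) (x : N) :
    C.p (T.ιT x) = x := by
  have hp : C.p (C.h (P.δ (T.ιT x))) = 0 := LinearMap.congr_fun C.p_h _
  have hι : C.p (C.ι x) = x := LinearMap.congr_fun C.p_ι x
  rw [T.ιT_apply_s4 hsmall x, map_add, hp, hι, add_zero]

end PerturbedMaps

theorem IsSmall.eq_zero_of_apply_eq {𝓜 : DGModule R M} {𝓝 : DGModule R N}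
    {C : Contraction 𝓜 𝓝} {P : Perturbation 𝓜} (hsmall : IsSmall C P) {x : M}
    (hx : C.h (P.δ x) = x) : x = 0 := by
  obtain ⟨k, hk⟩ := hsmall x
  rw [Module.End.pow_apply] at hk
  exact (Function.iterate_fixed (f := C.h ∘ₗ P.δ) hx k).symm.trans hk

/-- The perturbed inclusion is a chain map for the perturbed differentials. -/
theorem PerturbedMaps.chain_ιT {𝓜 : DGModule R M} {𝓝 : DGModule R N}
    {C : Contraction 𝓜 𝓝} {P : Perturbation 𝓜} (T : PerturbedMaps C P)
    (hsmall : IsSmall C P) (x : N) :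
    (𝓜.d + P.δ) (T.ιT x) = T.ιT ((𝓝.d + T.δT) x) := by
  have hD : (𝓜.d + P.δ) (T.ιT x) =
      C.ι ((𝓝.d + T.δT) x) + C.h (P.δ ((𝓜.d + P.δ) (T.ιT x))) := by
    have hd : 𝓜.d (T.ιT x) = 𝓜.d (C.ι x) + 𝓜.d (C.h (P.δ (T.ιT x))) := by
      rw [← map_add, ← T.ιT_apply_s4 hsmall x]
    have hι : 𝓜.d (C.ι x) = C.ι (𝓝.d x) := LinearMap.congr_fun C.chain_ι x
    have hh : C.ι (C.p (P.δ (T.ιT x))) - P.δ (T.ιT x) =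
        C.h (𝓜.d (P.δ (T.ιT x))) + 𝓜.d (C.h (P.δ (T.ιT x))) :=
      LinearMap.congr_fun C.homotopy (P.δ (T.ιT x))
    have hdd : 𝓜.d (𝓜.d (T.ιT x)) = 0 := LinearMap.congr_fun 𝓜.d_sq _
    have hsq : (𝓜.d + P.δ) ((𝓜.d + P.δ) (T.ιT x)) = 0 := LinearMap.congr_fun P.sq _
    have hδ : P.δ ((𝓜.d + P.δ) (T.ιT x)) = -𝓜.d (P.δ (T.ιT x)) := by
      rw [LinearMap.add_apply, LinearMap.add_apply, map_add, hdd, zero_add] at hsq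
      exact eq_neg_of_add_eq_zero_right hsq
    rw [hδ, LinearMap.add_apply, LinearMap.add_apply, hd, hι, map_add, map_neg,
      T.δT_apply_s4 hsmall x, sub_eq_iff_eq_add.mp hh]
    abel
  rw [← sub_eq_zero]
  apply hsmall.eq_zero_of_apply_eq
  rw [map_sub, map_sub]
  conv_rhs => rw [hD, T.ιT_apply_s4 hsmall ((𝓝.d + T.δT) x)]
  abel

/-- Given a contraction of `(M, d_M)` onto `(N, d_N)` and a small perturbation `δ` of `d_M`,
the perturbed differential on `N` squares to zero, so `(N, d_N + δ̃)` is again a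
differential graded module. -/
theorem perturbed_differential_sq_zero {𝓜 : DGModule R M} {𝓝 : DGModule R N}
    (C : Contraction 𝓜 𝓝) (P : Perturbation 𝓜)
    (hsmall : IsSmall C P) (T : PerturbedMaps C P) :
    (𝓝.d + T.δT) ∘ₗ (𝓝.d + T.δT) = 0 := by
  ext x
  have h : T.ιT ((𝓝.d + T.δT) ((𝓝.d + T.δT) x)) = 0 := by
    rw [← T.chain_ιT hsmall, ← T.chain_ιT hsmall]
    exact LinearMap.congr_fun P.sq _
  rw [LinearMap.comp_apply, ← T.p_ιT_apply hsmall ((𝓝.d + T.δT) ((𝓝.d + T.δT) x)), h, map_zero,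
    LinearMap.zero_apply]

end BVHPT
end

section
/- Given a contraction of (M, d_M) onto (N, d_N) and a small perturbation δ of d_M, the perturbed maps satisfy p̃ ∘ ι̃ = id_N and the side conditions h̃ ∘ h̃ = 0, h̃ ∘ ι̃ = 0 and p̃ ∘ h̃ = 0. -/
namespace BVHPT

variable {R M N : Type*} [CommRing R] [AddCommGroup M] [Module R M]
  [AddCommGroup N] [Module R N]

section

variable {𝓜 : DGModule R M} {𝓝 : DGModule R N} {C : Contraction 𝓜 𝓝} {P : Perturbation 𝓜}

theorem Contraction.h_pow_apply_eq_zero (C : Contraction 𝓜 𝓝) (P : Perturbation 𝓜) {y : M}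
    (hy : C.h y = 0) (n : ℕ) : C.h (((C.h ∘ₗ P.δ) ^ n) y) = 0 := by
  cases n with
  | zero => simpa using hy
  | succ n =>
    rw [pow_succ', Module.End.mul_apply]
    exact LinearMap.congr_fun C.h_h _

theorem Contraction.p_pow_succ_apply (C : Contraction 𝓜 𝓝) (P : Perturbation 𝓜) (y : M)
    (n : ℕ) : C.p (((C.h ∘ₗ P.δ) ^ (n + 1)) y) = 0 := by
  rw [pow_succ', Module.End.mul_apply]
  exact LinearMap.congr_fun C.p_h _

theorem PerturbedMaps.h_ιT (hsmall : IsSmall C P) (T : PerturbedMaps C P) (x : N) :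
    C.h (T.ιT x) = 0 := by
  obtain ⟨k, hk⟩ := hsmall (C.ι x)
  rw [T.ιT_spec x k hk, map_sum]
  exact Finset.sum_eq_zero fun n _ =>
    C.h_pow_apply_eq_zero P (LinearMap.congr_fun C.h_ι x) n

theorem PerturbedMaps.h_hT (hsmall : IsSmall C P) (T : PerturbedMaps C P) (x : M) :
    C.h (T.hT x) = 0 := by
  obtain ⟨k, hk⟩ := hsmall (C.h x)
  rw [T.hT_spec x k hk, map_sum]
  exact Finset.sum_eq_zero fun n _ =>
    C.h_pow_apply_eq_zero P (LinearMap.congr_fun C.h_h x) n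

theorem PerturbedMaps.p_ιT (hsmall : IsSmall C P) (T : PerturbedMaps C P) (x : N) :
    C.p (T.ιT x) = x := by
  obtain ⟨k, hk⟩ := hsmall (C.ι x)
  have hk' : ((C.h ∘ₗ P.δ) ^ (k + 1)) (C.ι x) = 0 := by
    rw [pow_succ', Module.End.mul_apply, hk, map_zero]
  rw [T.ιT_spec x (k + 1) hk', map_sum, Finset.sum_range_succ',
    Finset.sum_eq_zero fun n _ => C.p_pow_succ_apply P (C.ι x) n, zero_add]
  exact LinearMap.congr_fun C.p_ι x

theorem PerturbedMaps.p_hT (hsmall : IsSmall C P) (T : PerturbedMaps C P) (x : M) :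
    C.p (T.hT x) = 0 := by
  obtain ⟨k, hk⟩ := hsmall (C.h x)
  rw [T.hT_spec x k hk, map_sum]
  refine Finset.sum_eq_zero fun n _ => ?_
  cases n with
  | zero => exact LinearMap.congr_fun C.p_h x
  | succ n => exact C.p_pow_succ_apply P _ n

theorem PerturbedMaps.hT_apply_eq_zero (T : PerturbedMaps C P) {y : M} (hy : C.h y = 0) :
    T.hT y = 0 := by
  simpa using T.hT_spec y 0 (by simpa using hy)

theorem PerturbedMaps.pT_apply_eq (T : PerturbedMaps C P) {y : M} (hy : C.h y = 0) :
    T.pT y = C.p y := by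
  simpa using T.pT_spec y 1 (by simp [hy])

end

/-- Given a contraction of `(M, d_M)` onto `(N, d_N)` and a small perturbation `δ` of `d_M`,
the perturbed maps satisfy `p̃ ∘ ι̃ = id_N` and the side conditions
`h̃ ∘ h̃ = 0`, `h̃ ∘ ι̃ = 0` and `p̃ ∘ h̃ = 0`. -/
theorem perturbed_side_conditions {𝓜 : DGModule R M} {𝓝 : DGModule R N}
    (C : Contraction 𝓜 𝓝) (P : Perturbation 𝓜)
    (hsmall : IsSmall C P) (T : PerturbedMaps C P) :
    (T.pT ∘ₗ T.ιT = LinearMap.id) ∧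
    (T.hT ∘ₗ T.hT = 0) ∧ (T.hT ∘ₗ T.ιT = 0) ∧ (T.pT ∘ₗ T.hT = 0) := by
  refine ⟨LinearMap.ext fun x => ?_, LinearMap.ext fun x => ?_, LinearMap.ext fun x => ?_,
    LinearMap.ext fun x => ?_⟩
  · exact (T.pT_apply_eq (T.h_ιT hsmall x)).trans (T.p_ιT hsmall x)
  · exact T.hT_apply_eq_zero (T.h_hT hsmall x)
  · exact T.hT_apply_eq_zero (T.h_ιT hsmall x)
  · exact (T.pT_apply_eq (T.h_hT hsmall x)).trans (T.p_hT hsmall x)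

end BVHPT
end

section
/- (The side conditions can always be arranged.) Let (M, d_M) and (N, d_N) be differential graded modules, ι : N → M and p : M → N chain maps of degree 0 with p ∘ ι = id_N, and h : M → M an R-linear map of degree −1 with ι ∘ p − id_M = h ∘ d_M + d_M ∘ h. Then there exists an R-linear map h' : M → M of degree −1 such that ι ∘ p − id_M = h' ∘ d_M + d_M ∘ h' and in addition h' ∘ h' = 0, h' ∘ ι = 0 and p ∘ h' = 0. -/
namespace BVHPT

variable {R M N : Type*} [CommRing R] [AddCommGroup M] [Module R M]
  [AddCommGroup N] [Module R N]

/-- In a ring, let `d ^ 2 = 0` and let `e = h d + d h` satisfy `e ^ 2 = -e`. Writing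
`k = e h e`, the element `-(k d k)` is again a homotopy for `e`, and it squares to zero. -/
theorem homotopy_and_sq_zero_of_compress {A : Type*} [Ring A] {d h e k : A} (hd : d * d = 0)
    (he : e = h * d + d * h) (hee : e * e = -e) (hk : k = e * h * e) :
    e = -(k * d * k) * d + d * -(k * d * k) ∧ -(k * d * k) * -(k * d * k) = 0 := by
  have hde : d * e = e * d := by
    rw [he]
    linear_combination (norm := noncomm_ring) hd * h - h * hd
  have hke : k * e = -k := by
    rw [hk, mul_assoc, hee, mul_neg]
  have hek : e * k = -k := by
    rw [hk, ← mul_assoc, ← mul_assoc, hee, neg_mul, neg_mul]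
  have hhom : k * d + d * k = e := by
    calc k * d + d * k = e * h * (e * d) + d * e * h * e := by rw [hk]; noncomm_ring
      _ = e * h * (d * e) + e * d * h * e := by rw [hde]
      _ = e * (h * d + d * h) * e := by noncomm_ring
      _ = e := by rw [← he, hee, neg_mul, hee, neg_neg]
  have hkd : k * d = e - d * k := eq_sub_of_add_eq hhom
  have hkdk : k * d * k = -k - d * k * k := by rw [hkd, sub_mul, hek]
  have hkdk' : k * d * k = -k - k * k * d := by
    rw [mul_assoc, eq_sub_of_add_eq' hhom, mul_sub, hke, mul_assoc]
  have hcomm : d * k * k = k * k * d := sub_right_injective (hkdk.symm.trans hkdk')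
  constructor
  · calc e = k * d + d * k := hhom.symm
      _ = -(-k - k * k * d) * d + d * -(-k - d * k * k) := by
        linear_combination (norm := noncomm_ring) -(k * k * hd) - hd * k * k
      _ = _ := by rw [← hkdk, ← hkdk']
  · calc -(k * d * k) * -(k * d * k) = k * (d * k * k) * d * k := by noncomm_ring
      _ = k * k * k * (d * d) * k := by rw [hcomm]; noncomm_ring
      _ = 0 := by rw [hd, mul_zero, zero_mul]

/-- **The side conditions can always be arranged.** If `ι`, `p` are degree-0 chain maps
with `p ∘ ι = id_N` and `h` is a degree `−1` homotopy with `ι ∘ p − id_M = h d_M + d_M h`,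
then there is a degree `−1` map `h'` satisfying the same homotopy relation together with
the side conditions `h' ∘ h' = 0`, `h' ∘ ι = 0` and `p ∘ h' = 0`. -/
theorem side_conditions_can_be_arranged (𝓜 : DGModule R M) (𝓝 : DGModule R N)
    (ι : N →ₗ[R] M) (p : M →ₗ[R] N) (h : M →ₗ[R] M)
    (hι_deg : ∀ i : ℤ, ∀ x ∈ 𝓝.grading i, ι x ∈ 𝓜.grading i)
    (hp_deg : ∀ i : ℤ, ∀ x ∈ 𝓜.grading i, p x ∈ 𝓝.grading i)
    (hh_deg : ∀ i : ℤ, ∀ x ∈ 𝓜.grading i, h x ∈ 𝓜.grading (i - 1))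
    (hchain_ι : 𝓜.d ∘ₗ ι = ι ∘ₗ 𝓝.d)
    (hchain_p : 𝓝.d ∘ₗ p = p ∘ₗ 𝓜.d)
    (hpι : p ∘ₗ ι = LinearMap.id)
    (hhom : ι ∘ₗ p - LinearMap.id = h ∘ₗ 𝓜.d + 𝓜.d ∘ₗ h) :
    ∃ h' : M →ₗ[R] M,
      (∀ i : ℤ, ∀ x ∈ 𝓜.grading i, h' x ∈ 𝓜.grading (i - 1)) ∧
      (ι ∘ₗ p - LinearMap.id = h' ∘ₗ 𝓜.d + 𝓜.d ∘ₗ h') ∧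
      (h' ∘ₗ h' = 0) ∧ (h' ∘ₗ ι = 0) ∧ (p ∘ₗ h' = 0) := by
  have hpι' (y : N) : p (ι y) = y := LinearMap.congr_fun hpι y
  set e : Module.End R M := ι ∘ₗ p - LinearMap.id with he
  have heι (y : N) : e (ι y) = 0 := by simp [he, hpι']
  have hpe (x : M) : p (e x) = 0 := by simp [he, hpι']
  have hee : e * e = -e := by
    ext x
    simp [he, hpι']
  have he_deg (i : ℤ) (x : M) (hx : x ∈ 𝓜.grading i) : e x ∈ 𝓜.grading i :=
    sub_mem (hι_deg i _ (hp_deg i x hx)) hx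
  set k : Module.End R M := e * h * e with hk
  have hk_deg (i : ℤ) (x : M) (hx : x ∈ 𝓜.grading i) : k x ∈ 𝓜.grading (i - 1) :=
    he_deg _ _ (hh_deg _ _ (he_deg _ _ hx))
  obtain ⟨hhom', hsq⟩ := homotopy_and_sq_zero_of_compress (d := 𝓜.d) 𝓜.d_sq hhom hee hk
  refine ⟨-(k * 𝓜.d * k), fun i x hx => neg_mem ?_, hhom', hsq, ?_, ?_⟩
  · simpa using hk_deg _ _ (𝓜.d_deg _ _ (hk_deg i x hx))
  · ext y
    simp [hk, heι]
  · ext x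
    simp [hk, hpe]

end BVHPT
end

section
/- For all homogeneous f, g ∈ A, the derived bracket satisfies the graded commutation relation {f,g} = −(−1)^{(|f|+1)(|g|+1)} {g,f}. (No condition on Δ beyond R-linearity and degree +1 is needed.) -/
namespace BVAlg

variable {R A : Type*} [CommRing R] [Ring A] [Algebra R A]

/-- The sign `(−1)^k` applied to an element of an additive group. -/
def gsign {V : Type*} [AddCommGroup V] (k : ℤ) (a : V) : V := if Even k then a else -a

/-- The derived bracket of an odd operator `Δ`:
`{f,g} := (−1)^{|f|}(Δ(fg) − (Δf)g) − f(Δg)`, where `i = |f|` is the degree of `f`. -/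
def dbracket (Δ : A →ₗ[R] A) (i : ℤ) (f g : A) : A :=
  gsign i (Δ (f * g) - Δ f * g) - f * Δ g


/-- For homogeneous `f, g`, the derived bracket satisfies the graded commutation relation
`{f,g} = −(−1)^{(|f|+1)(|g|+1)} {g,f}`. -/
theorem dbracket_graded_comm (𝒜 : ℤ → Submodule R A) [GradedAlgebra 𝒜]
    (h2 : IsUnit (2 : R))
    (hcomm : ∀ (i j : ℤ) (f g : A), f ∈ 𝒜 i → g ∈ 𝒜 j → f * g = gsign (i * j) (g * f))
    (Δ : A →ₗ[R] A) (hΔ : ∀ i : ℤ, ∀ f ∈ 𝒜 i, Δ f ∈ 𝒜 (i + 1)) :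
    ∀ (i j : ℤ) (f g : A), f ∈ 𝒜 i → g ∈ 𝒜 j →
      dbracket Δ i f g = -gsign ((i + 1) * (j + 1)) (dbracket Δ j g f) := by
  intro i j f g hf hg
  have hfg := hcomm i j f g hf hg
  have hΔfg := hcomm (i + 1) j (Δ f) g (hΔ i f hf) hg
  have hfΔg := hcomm i (j + 1) f (Δ g) hf (hΔ j g hg)
  unfold dbracket
  rw [hfg, hΔfg, hfΔg]
  by_cases hi : Even i <;> by_cases hj : Even j <;>
    simp only [gsign, Int.even_mul, Int.even_add_one, hi, hj, not_true_eq_false,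
      not_false_eq_true, or_true, or_false, or_self, if_true, if_false, map_neg] <;>
    abel

end BVAlg
end

section
/- If Δ ∘ Δ = 0, then Δ is a derivation of the derived bracket: for all homogeneous f, g ∈ A, Δ{f,g} = {Δf, g} + (−1)^{|f|+1} {f, Δg}. -/
namespace BVAlg

variable {R A : Type*} [CommRing R] [Ring A] [Algebra R A]

/-- If `Δ ∘ Δ = 0`, then `Δ` is a derivation of the derived bracket:
`Δ{f,g} = {Δf, g} + (−1)^{|f|+1} {f, Δg}` for homogeneous `f, g`. -/
theorem delta_derivation_of_dbracket (𝒜 : ℤ → Submodule R A) [GradedAlgebra 𝒜]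
    (h2 : IsUnit (2 : R))
    (hcomm : ∀ (i j : ℤ) (f g : A), f ∈ 𝒜 i → g ∈ 𝒜 j → f * g = gsign (i * j) (g * f))
    (Δ : A →ₗ[R] A) (hΔ : ∀ i : ℤ, ∀ f ∈ 𝒜 i, Δ f ∈ 𝒜 (i + 1))
    (hΔ2 : Δ ∘ₗ Δ = 0) :
    ∀ (i j : ℤ) (f g : A), f ∈ 𝒜 i → g ∈ 𝒜 j →
      Δ (dbracket Δ i f g) =
        dbracket Δ (i + 1) (Δ f) g + gsign (i + 1) (dbracket Δ i f (Δ g)) := by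
  have hΔΔ (x : A) : Δ (Δ x) = 0 := LinearMap.congr_fun hΔ2 x
  intro i j f g _ _
  by_cases hi : Even i
  · have hi' : ¬ Even (i + 1) := by rwa [Int.even_add_one, not_not]
    simp only [dbracket, gsign, if_pos hi, if_neg hi', map_sub, hΔΔ, zero_mul, mul_zero]
    abel
  · have hi' : Even (i + 1) := Int.even_add_one.mpr hi
    simp only [dbracket, gsign, if_neg hi, if_pos hi', map_sub, map_neg, hΔΔ, zero_mul, mul_zero]
    abel

end BVAlg
end

section
/- Suppose Δ ∘ Δ = 0 and the derived bracket satisfies the graded Leibniz rule {f, gh} = {f,g}h + (−1)^{|g|(|f|+1)} g{f,h} for all homogeneous f, g, h (i.e. Δ is a second-order operator). Then the derived bracket satisfies the graded Jacobi identity: for all homogeneous f, g, h, (−1)^{(|h|+1)(|g|+1)} {h,{f,g}} + (−1)^{(|g|+1)(|f|+1)} {g,{h,f}} + (−1)^{(|f|+1)(|h|+1)} {f,{g,h}} = 0. In particular (A, ·, {·,·}) is a Gerstenhaber algebra. -/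
namespace BVAlg

variable {R A : Type*} [CommRing R] [Ring A] [Algebra R A]

theorem gsign_mem {𝒜 : ℤ → Submodule R A} {i : ℤ} (k : ℤ) {a : A} (ha : a ∈ 𝒜 i) :
    gsign k a ∈ 𝒜 i := by
  unfold gsign
  split_ifs
  · exact ha
  · exact neg_mem ha

theorem map_gsign (Δ : A →ₗ[R] A) (k : ℤ) (a : A) : Δ (gsign k a) = gsign k (Δ a) := by
  unfold gsign
  split_ifs <;> simp

theorem dbracket_add_right (Δ : A →ₗ[R] A) (i : ℤ) (f a b : A) :
    dbracket Δ i f (a + b) = dbracket Δ i f a + dbracket Δ i f b := by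
  unfold dbracket gsign
  split_ifs <;> simp only [mul_add, map_add] <;> abel

theorem dbracket_neg_right (Δ : A →ₗ[R] A) (i : ℤ) (f a : A) :
    dbracket Δ i f (-a) = -dbracket Δ i f a := by
  unfold dbracket gsign
  split_ifs <;> simp only [mul_neg, map_neg] <;> abel

theorem dbracket_gsign_right (Δ : A →ₗ[R] A) (i k : ℤ) (f a : A) :
    dbracket Δ i f (gsign k a) = gsign k (dbracket Δ i f a) := by
  unfold gsign
  split_ifs <;> simp only [dbracket_neg_right]

/-- The defining expansion of `Δ` on a product. -/
theorem map_mul_eq_dbracket (Δ : A →ₗ[R] A) (i : ℤ) (f g : A) :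
    Δ (f * g) = Δ f * g + gsign i (dbracket Δ i f g) + gsign i (f * Δ g) := by
  unfold dbracket gsign
  split_ifs <;> abel

theorem dbracket_mem {𝒜 : ℤ → Submodule R A} [GradedAlgebra 𝒜] {Δ : A →ₗ[R] A}
    (hΔ : ∀ i : ℤ, ∀ f ∈ 𝒜 i, Δ f ∈ 𝒜 (i + 1)) {i j : ℤ} {f g : A}
    (hf : f ∈ 𝒜 i) (hg : g ∈ 𝒜 j) : dbracket Δ i f g ∈ 𝒜 (i + j + 1) := by
  refine sub_mem (gsign_mem _ (sub_mem (hΔ _ _ (SetLike.mul_mem_graded hf hg)) ?_)) ?_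
  · convert SetLike.mul_mem_graded (hΔ _ _ hf) hg using 2
    ring
  · convert SetLike.mul_mem_graded hf (hΔ _ _ hg) using 2
    ring

/-- Graded symmetry of the derived bracket. -/
theorem dbracket_comm {𝒜 : ℤ → Submodule R A} [GradedAlgebra 𝒜]
    (hcomm : ∀ (i j : ℤ) (f g : A), f ∈ 𝒜 i → g ∈ 𝒜 j → f * g = gsign (i * j) (g * f))
    {Δ : A →ₗ[R] A} (hΔ : ∀ i : ℤ, ∀ f ∈ 𝒜 i, Δ f ∈ 𝒜 (i + 1)) {i j : ℤ} {f g : A}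
    (hf : f ∈ 𝒜 i) (hg : g ∈ 𝒜 j) :
    dbracket Δ i f g = -gsign ((i + 1) * (j + 1)) (dbracket Δ j g f) := by
  have h₁ := hcomm _ _ _ _ (hΔ _ _ hf) hg
  have h₂ := hcomm _ _ _ _ hf (hΔ _ _ hg)
  have h₃ := congrArg Δ (hcomm _ _ _ _ hf hg)
  rw [map_gsign] at h₃
  unfold dbracket
  rw [h₁, h₂, h₃]
  by_cases hi : Even i <;> by_cases hj : Even j <;>
    simp only [gsign, Int.even_add_one, Int.even_mul, hi, hj, not_true_eq_false,
      not_false_eq_true, or_true, or_false, or_self, if_true, if_false] <;>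
    abel

/-- A square-zero operator is a derivation of its derived bracket. -/
theorem map_dbracket {Δ : A →ₗ[R] A} (hΔ2 : Δ ∘ₗ Δ = 0) (i : ℤ) (f g : A) :
    Δ (dbracket Δ i f g) = dbracket Δ (i + 1) (Δ f) g - gsign i (dbracket Δ i f (Δ g)) := by
  have hsq (a : A) : Δ (Δ a) = 0 := LinearMap.congr_fun hΔ2 a
  by_cases hi : Even i <;>
    simp only [dbracket, gsign, Int.even_add_one, hi, not_true_eq_false, not_false_eq_true,
      if_true, if_false, map_sub, map_neg, hsq, zero_mul, mul_zero, sub_zero] <;>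
    abel

/-- If `Δ ∘ Δ = 0` and the derived bracket satisfies the graded Leibniz rule (i.e. `Δ` is a
second-order operator), then the derived bracket satisfies the graded Jacobi identity,
so that `(A, ·, {·,·})` is a Gerstenhaber algebra. -/
theorem dbracket_graded_jacobi (𝒜 : ℤ → Submodule R A) [GradedAlgebra 𝒜]
    (h2 : IsUnit (2 : R))
    (hcomm : ∀ (i j : ℤ) (f g : A), f ∈ 𝒜 i → g ∈ 𝒜 j → f * g = gsign (i * j) (g * f))
    (Δ : A →ₗ[R] A) (hΔ : ∀ i : ℤ, ∀ f ∈ 𝒜 i, Δ f ∈ 𝒜 (i + 1))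
    (hΔ2 : Δ ∘ₗ Δ = 0)
    (hLeib : ∀ (i j k : ℤ) (f g h : A), f ∈ 𝒜 i → g ∈ 𝒜 j → h ∈ 𝒜 k →
      dbracket Δ i f (g * h) =
        dbracket Δ i f g * h + gsign (j * (i + 1)) (g * dbracket Δ i f h)) :
    ∀ (i j k : ℤ) (f g h : A), f ∈ 𝒜 i → g ∈ 𝒜 j → h ∈ 𝒜 k →
      gsign ((k + 1) * (j + 1)) (dbracket Δ k h (dbracket Δ i f g)) +
        gsign ((j + 1) * (i + 1)) (dbracket Δ j g (dbracket Δ k h f)) +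
        gsign ((i + 1) * (k + 1)) (dbracket Δ i f (dbracket Δ j g h)) = 0 := by
  intro i j k f g h hf hg hh
  have hfg := dbracket_mem hΔ hf hg
  have key := map_dbracket hΔ2 i f (g * h)
  rw [hLeib _ _ _ _ _ _ hf hg hh, map_add, map_gsign, map_mul_eq_dbracket Δ (i + j + 1),
    map_mul_eq_dbracket Δ j g, map_mul_eq_dbracket Δ j g, map_dbracket hΔ2, map_dbracket hΔ2,
    hLeib _ _ _ _ _ _ (hΔ _ _ hf) hg hh, dbracket_add_right, dbracket_add_right,
    dbracket_gsign_right, dbracket_gsign_right, hLeib _ _ _ _ _ _ hf (hΔ _ _ hg) hh,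
    hLeib _ _ _ _ _ _ hf hg (hΔ _ _ hh), dbracket_comm hcomm hΔ hfg hh] at key
  have hswap : dbracket Δ j g (dbracket Δ k h f) =
      -gsign ((k + 1) * (i + 1)) (dbracket Δ j g (dbracket Δ i f h)) := by
    rw [dbracket_comm hcomm hΔ hh hf, dbracket_neg_right, dbracket_gsign_right]
  rw [hswap]
  by_cases hi : Even i <;> by_cases hj : Even j <;> by_cases hk : Even k <;>
    simp only [gsign, Int.even_add, Int.even_mul, hi, hj, hk, Int.not_even_one, iff_true, iff_false,
      not_true_eq_false, or_true, or_false, or_self, if_true, if_false, sub_mul, mul_sub,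
      neg_mul, mul_neg] at key ⊢ <;>
    grind

end BVAlg
end

section
/- The BRST operator squares to zero: δ_BRST ∘ δ_BRST = 0 as an operator on H. -/
namespace BVBRST

variable {R A H : Type*} [CommRing R] [AddCommGroup A] [Module R A]
  [AddCommGroup H] [Module R H]

/-- The sign `(−1)^k` applied to an element of an additive group. -/
def gsign {V : Type*} [AddCommGroup V] (k : ℤ) (a : V) : V := if Even k then a else -a

/-- An odd graded Lie structure on a ℤ-graded `R`-module `A`, together with a compatible
square-zero differential `δ₀` of degree `+1` which is a derivation of the bracket. -/
structure OddGradedLieModule (R A : Type*) [CommRing R] [AddCommGroup A] [Module R A] where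
  grading : ℤ → Submodule R A
  internal : DirectSum.IsInternal grading
  br : A →ₗ[R] A →ₗ[R] A
  br_deg : ∀ i j : ℤ, ∀ f ∈ grading i, ∀ g ∈ grading j, br f g ∈ grading (i + j + 1)
  br_comm : ∀ i j : ℤ, ∀ f ∈ grading i, ∀ g ∈ grading j,
    br f g = -gsign ((i + 1) * (j + 1)) (br g f)
  br_jacobi : ∀ i j k : ℤ, ∀ f ∈ grading i, ∀ g ∈ grading j, ∀ h ∈ grading k,
    gsign ((k + 1) * (j + 1)) (br h (br f g)) +
      gsign ((j + 1) * (i + 1)) (br g (br h f)) +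
      gsign ((i + 1) * (k + 1)) (br f (br g h)) = 0
  δ₀ : A →ₗ[R] A
  δ₀_deg : ∀ i : ℤ, ∀ f ∈ grading i, δ₀ f ∈ grading (i + 1)
  δ₀_sq : δ₀ ∘ₗ δ₀ = 0
  δ₀_der : ∀ i j : ℤ, ∀ f ∈ grading i, ∀ g ∈ grading j,
    δ₀ (br f g) = br (δ₀ f) g + gsign (i + 1) (br f (δ₀ g))

/-- A contraction of `(A, δ₀)` onto `(H, 0)`. -/
structure ContractionOntoH (𝒜 : OddGradedLieModule R A)
    (H : Type*) [AddCommGroup H] [Module R H] where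
  grading : ℤ → Submodule R H
  internal : DirectSum.IsInternal grading
  ι : H →ₗ[R] A
  p : A →ₗ[R] H
  h : A →ₗ[R] A
  ι_deg : ∀ i : ℤ, ∀ x ∈ grading i, ι x ∈ 𝒜.grading i
  p_deg : ∀ i : ℤ, ∀ x ∈ 𝒜.grading i, p x ∈ grading i
  h_deg : ∀ i : ℤ, ∀ x ∈ 𝒜.grading i, h x ∈ 𝒜.grading (i - 1)
  δ_ι : 𝒜.δ₀ ∘ₗ ι = 0
  p_δ : p ∘ₗ 𝒜.δ₀ = 0
  p_ι : p ∘ₗ ι = LinearMap.id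
  homotopy : ι ∘ₗ p - LinearMap.id = h ∘ₗ 𝒜.δ₀ + 𝒜.δ₀ ∘ₗ h
  h_h : h ∘ₗ h = 0
  h_ι : h ∘ₗ ι = 0
  p_h : p ∘ₗ h = 0

/-- The BRST operator `δ_BRST := p ∘ {S₁, ·} ∘ ι` on `H`. -/
def δBRST {𝒜 : OddGradedLieModule R A} (C : ContractionOntoH 𝒜 H) (S₁ : A) :
    H →ₗ[R] H :=
  C.p ∘ₗ 𝒜.br S₁ ∘ₗ C.ι


theorem gsign_of_even {V : Type*} [AddCommGroup V] {k : ℤ} (hk : Even k) (a : V) :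
    gsign k a = a := if_pos hk

theorem gsign_of_not_even {V : Type*} [AddCommGroup V] {k : ℤ} (hk : ¬Even k) (a : V) :
    gsign k a = -a := if_neg hk

theorem gsign_zero {V : Type*} [AddCommGroup V] (k : ℤ) : gsign k (0 : V) = 0 := by
  simp [gsign]

/-- To prove an additive property of all elements of an internally graded module, it suffices to
prove it for homogeneous elements. -/
theorem induction_homogeneous {M : Type*} [AddCommGroup M] [Module R M] {ℳ : ℤ → Submodule R M}
    (hℳ : DirectSum.IsInternal ℳ) {P : M → Prop} (mem : ∀ i, ∀ x ∈ ℳ i, P x) (zero : P 0)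
    (add : ∀ x y, P x → P y → P (x + y)) (x : M) : P x :=
  Submodule.iSup_induction ℳ (motive := P)
    (hℳ.submodule_iSup_eq_top ▸ Submodule.mem_top) mem zero add

namespace OddGradedLieModule

variable (𝒜 : OddGradedLieModule R A)

/-- Bracketing with a closed element of degree `0` anticommutes with `δ₀`. -/
theorem δ₀_br_of_closed_left {S : A} (hS : S ∈ 𝒜.grading 0) (hdS : 𝒜.δ₀ S = 0) (a : A) :
    𝒜.δ₀ (𝒜.br S a) = -𝒜.br S (𝒜.δ₀ a) := by
  induction a using induction_homogeneous 𝒜.internal with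
  | mem j a ha =>
    rw [𝒜.δ₀_der 0 j S hS a ha, hdS, gsign_of_not_even (by decide)]
    simp
  | zero => simp
  | add x y hx hy => simp only [map_add, hx, hy, neg_add]

/-- Bracketing with a homogeneous closed element on the right commutes with `δ₀`. -/
theorem δ₀_br_of_closed_right {j : ℤ} {g : A} (hg : g ∈ 𝒜.grading j) (hdg : 𝒜.δ₀ g = 0) (u : A) :
    𝒜.δ₀ (𝒜.br u g) = 𝒜.br (𝒜.δ₀ u) g := by
  induction u using induction_homogeneous 𝒜.internal with
  | mem i u hu =>
    rw [𝒜.δ₀_der i j u hu g hg, hdg, map_zero, gsign_zero, add_zero]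
  | zero => simp
  | add x y hx hy => simp only [map_add, LinearMap.add_apply, hx, hy]

/-- For `S` of degree `0`, twice the square of `{S, ·}` is `{{S, S}, ·}`. -/
theorem br_br_self_add {S : A} (hS : S ∈ 𝒜.grading 0) {k : ℤ} {a : A} (ha : a ∈ 𝒜.grading k) :
    𝒜.br S (𝒜.br S a) + 𝒜.br S (𝒜.br S a) = 𝒜.br (𝒜.br S S) a := by
  have jac := 𝒜.br_jacobi 0 0 k S hS S hS a ha
  have comm := 𝒜.br_comm k 0 a ha S hS
  have comm' := 𝒜.br_comm k (0 + 0 + 1) a ha _ (𝒜.br_deg 0 0 S hS S hS)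
  rw [gsign_of_even (by simp [parity_simps])] at comm'
  rw [comm, comm'] at jac
  by_cases hk : Even (k + 1)
  · simp only [zero_add, mul_one, one_mul, gsign_of_even hk,
      gsign_of_not_even Int.not_even_one, map_neg, neg_neg] at jac
    rw [add_assoc, neg_add_eq_zero] at jac
    exact jac.symm
  · simp only [zero_add, mul_one, one_mul, gsign_of_not_even hk,
      gsign_of_not_even Int.not_even_one, neg_neg] at jac
    rw [add_assoc, ← neg_add, add_neg_eq_zero] at jac
    exact jac.symm

end OddGradedLieModule

theorem ContractionOntoH.ι_p_apply {𝒜 : OddGradedLieModule R A} (C : ContractionOntoH 𝒜 H)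
    (a : A) : C.ι (C.p a) = a + (C.h (𝒜.δ₀ a) + 𝒜.δ₀ (C.h a)) := by
  have := LinearMap.congr_fun C.homotopy a
  simp only [LinearMap.sub_apply, LinearMap.comp_apply, LinearMap.add_apply,
    LinearMap.id_apply] at this
  rw [← this, add_sub_cancel]

/-- The BRST operator squares to the projection of the square of `{S, ·}`. -/
theorem δBRST_δBRST_apply {𝒜 : OddGradedLieModule R A} (C : ContractionOntoH 𝒜 H) {S : A}
    (hS : S ∈ 𝒜.grading 0) (hdS : 𝒜.δ₀ S = 0) (x : H) :
    δBRST C S (δBRST C S x) = C.p (𝒜.br S (𝒜.br S (C.ι x))) := by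
  have hι : 𝒜.δ₀ (C.ι x) = 0 := LinearMap.congr_fun C.δ_ι x
  have hp (a : A) : C.p (𝒜.δ₀ a) = 0 := LinearMap.congr_fun C.p_δ a
  have hbr (a : A) : 𝒜.br S (𝒜.δ₀ a) = -𝒜.δ₀ (𝒜.br S a) := by
    rw [𝒜.δ₀_br_of_closed_left hS hdS, neg_neg]
  simp only [δBRST, LinearMap.comp_apply, C.ι_p_apply]
  simp [𝒜.δ₀_br_of_closed_left hS hdS (C.ι x), hι, hbr, hp]

/-- The BRST operator squares to zero: `δ_BRST ∘ δ_BRST = 0` as an operator on `H`. -/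
theorem BRST_sq_zero (h2 : IsUnit (2 : R))
    (𝒜 : OddGradedLieModule R A) (C : ContractionOntoH 𝒜 H)
    (S₁ : A) (hS₁mem : S₁ ∈ 𝒜.grading 0) (hdS₁ : 𝒜.δ₀ S₁ = 0) (hhS₁ : C.h S₁ = 0)
    (hexact : ∃ u : A, 𝒜.br S₁ S₁ = 𝒜.δ₀ u) :
    δBRST C S₁ ∘ₗ δBRST C S₁ = 0 := by
  obtain ⟨u, hu⟩ := hexact
  ext x
  rw [LinearMap.comp_apply, LinearMap.zero_apply]
  induction x using induction_homogeneous C.internal with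
  | mem k x hx =>
    rw [δBRST_δBRST_apply C hS₁mem hdS₁, ← h2.smul_eq_zero, two_smul, ← map_add,
      𝒜.br_br_self_add hS₁mem (C.ι_deg k x hx), hu,
      ← 𝒜.δ₀_br_of_closed_right (C.ι_deg k x hx) (LinearMap.congr_fun C.δ_ι x)]
    exact LinearMap.congr_fun C.p_δ _
  | zero => simp
  | add x y hx hy => rw [map_add, map_add, hx, hy, add_zero]

end BVBRST
end

section
/- Let S₂, …, S_n be elements of A₀ (n ≥ 2) and for 2 ≤ k ≤ n + 1 set T_k := (k!/2) Σ_{i+j=k, i,j≥1} {S_i, S_j}. Assume δ₀ S_k = −(1/k!) T_k for 2 ≤ k ≤ n. Then δ₀ T_{n+1} = 0 (and δ₀ T_k = 0 for all 2 ≤ k ≤ n + 1). -/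
namespace BVBRST

variable {R A H : Type*} [CommRing R] [AddCommGroup A] [Module R A]
  [AddCommGroup H] [Module R H]

/-- A sum over the triples of positive integers with sum `k` is invariant under rotating the
entries of the triples. -/
theorem sum_triples_rotate {V : Type*} [AddCommMonoid V] (k : ℕ) (φ : ℕ → ℕ → ℕ → V) :
    ∑ i ∈ Finset.Ico 1 k, ∑ a ∈ Finset.Ico 1 i, φ a (i - a) (k - i) =
      ∑ i ∈ Finset.Ico 1 k, ∑ a ∈ Finset.Ico 1 i, φ (k - i) a (i - a) := by
  rw [Finset.sum_sigma', Finset.sum_sigma']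
  refine Finset.sum_nbij' (fun x => ⟨k - x.2, x.1 - x.2⟩)
    (fun x => ⟨k - (x.1 - x.2), k - x.1⟩) ?_ ?_ ?_ ?_ ?_
  · rintro ⟨i, a⟩ hx
    simp only [Finset.mem_sigma, Finset.mem_Ico] at hx ⊢
    omega
  · rintro ⟨i, a⟩ hx
    simp only [Finset.mem_sigma, Finset.mem_Ico] at hx ⊢
    omega
  · rintro ⟨i, a⟩ hx
    simp only [Finset.mem_sigma, Finset.mem_Ico] at hx
    simp only [Sigma.mk.injEq, heq_eq_eq]
    omega
  · rintro ⟨i, a⟩ hx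
    simp only [Finset.mem_sigma, Finset.mem_Ico] at hx
    simp only [Sigma.mk.injEq, heq_eq_eq]
    omega
  · rintro ⟨i, a⟩ hx
    simp only [Finset.mem_sigma, Finset.mem_Ico] at hx
    dsimp only
    congr 1 <;> omega

namespace OddGradedLieModule

variable (𝒜 : OddGradedLieModule R A)

theorem jacobi_of_mem_zero {f g h : A} (hf : f ∈ 𝒜.grading 0) (hg : g ∈ 𝒜.grading 0)
    (hh : h ∈ 𝒜.grading 0) :
    𝒜.br f (𝒜.br g h) + 𝒜.br g (𝒜.br h f) + 𝒜.br h (𝒜.br f g) = 0 := by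
  have H := 𝒜.br_jacobi 0 0 0 f hf g hg h hh
  simp only [gsign, zero_add, mul_one, Int.not_even_one, if_false] at H
  rw [← neg_eq_zero, ← H]
  abel

theorem br_comm_zero_one {f g : A} (hf : f ∈ 𝒜.grading 0) (hg : g ∈ 𝒜.grading 1) :
    𝒜.br f g = -𝒜.br g f := by
  simpa [gsign] using 𝒜.br_comm 0 1 f hf g hg

theorem δ₀_br_of_mem_zero {f g : A} (hf : f ∈ 𝒜.grading 0) (hg : g ∈ 𝒜.grading 0) :
    𝒜.δ₀ (𝒜.br f g) = 𝒜.br (𝒜.δ₀ f) g + 𝒜.br (𝒜.δ₀ g) f := by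
  have H := 𝒜.δ₀_der 0 0 f hf g hg
  have hδg : 𝒜.δ₀ g ∈ 𝒜.grading 1 := by simpa using 𝒜.δ₀_deg 0 g hg
  simpa [gsign, 𝒜.br_comm_zero_one hf hδg] using H

/-- Summing the Jacobi identity over all triples of indices with sum `k`. -/
theorem three_nsmul_sum_br_br_eq_zero (S : ℕ → A) (k : ℕ)
    (hS : ∀ i, 1 ≤ i → i < k → S i ∈ 𝒜.grading 0) :
    3 • ∑ i ∈ Finset.Ico 1 k, ∑ a ∈ Finset.Ico 1 i,
      𝒜.br (S (k - i)) (𝒜.br (S a) (S (i - a))) = 0 := by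
  have h₁ := sum_triples_rotate k fun x y z => 𝒜.br (S x) (𝒜.br (S y) (S z))
  have h₂ := sum_triples_rotate k fun x y z => 𝒜.br (S y) (𝒜.br (S z) (S x))
  rw [succ_nsmul, two_nsmul]
  nth_rw 2 [← h₁]
  nth_rw 2 [← h₁]
  nth_rw 2 [← h₂]
  simp only [← Finset.sum_add_distrib]
  refine Finset.sum_eq_zero fun i hi => Finset.sum_eq_zero fun a ha => ?_
  rw [Finset.mem_Ico] at hi ha
  exact 𝒜.jacobi_of_mem_zero (hS _ (by omega) (by omega)) (hS _ (by omega) (by omega))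
    (hS _ (by omega) (by omega))

/-- The differential of `Σ_{i+j=k} {S_i, S_j}` for a solution `S` of the classical master equation
in orders below `k`. -/
theorem δ₀_sum_br (half : R) (hhalf : 2 * half = 1) (S : ℕ → A) (k : ℕ)
    (hS : ∀ i, 1 ≤ i → i < k → S i ∈ 𝒜.grading 0)
    (hδS : ∀ i, 1 ≤ i → i < k →
      𝒜.δ₀ (S i) = -(half • ∑ a ∈ Finset.Ico 1 i, 𝒜.br (S a) (S (i - a)))) :
    𝒜.δ₀ (∑ i ∈ Finset.Ico 1 k, 𝒜.br (S i) (S (k - i))) =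
      ∑ i ∈ Finset.Ico 1 k, ∑ a ∈ Finset.Ico 1 i,
        𝒜.br (S (k - i)) (𝒜.br (S a) (S (i - a))) := by
  have hsymm : ∑ i ∈ Finset.Ico 1 k, 𝒜.br (𝒜.δ₀ (S (k - i))) (S i) =
      ∑ i ∈ Finset.Ico 1 k, 𝒜.br (𝒜.δ₀ (S i)) (S (k - i)) := by
    refine Finset.sum_nbij' (k - ·) (k - ·) ?_ ?_ ?_ ?_ ?_ <;> intro i hi <;>
      simp only [Finset.mem_Ico] at hi ⊢
    · omega
    · omega
    · omega
    · omega
    · rw [Nat.sub_sub_self hi.2.le]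
  rw [map_sum, Finset.sum_congr rfl fun i hi => 𝒜.δ₀_br_of_mem_zero
    (hS i (Finset.mem_Ico.1 hi).1 (Finset.mem_Ico.1 hi).2)
    (hS (k - i) (by rw [Finset.mem_Ico] at hi; omega) (by rw [Finset.mem_Ico] at hi; omega)),
    Finset.sum_add_distrib, hsymm, ← two_smul R, Finset.smul_sum]
  refine Finset.sum_congr rfl fun i hi => ?_
  rw [Finset.mem_Ico] at hi
  rw [hδS i hi.1 hi.2, map_neg, map_smul, LinearMap.neg_apply, LinearMap.smul_apply, smul_neg,
    smul_smul, hhalf, one_smul, map_sum, LinearMap.sum_apply, ← Finset.sum_neg_distrib]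
  refine Finset.sum_congr rfl fun a ha => ?_
  rw [Finset.mem_Ico] at ha
  have hbr : 𝒜.br (S a) (S (i - a)) ∈ 𝒜.grading 1 := by
    simpa using 𝒜.br_deg 0 0 _ (hS a (by omega) (by omega)) _ (hS (i - a) (by omega) (by omega))
  exact (𝒜.br_comm_zero_one (hS (k - i) (by omega) (by omega)) hbr).symm

end OddGradedLieModule

/-- Let `S₂, …, S_n ∈ A₀` and set `T_k := (k!/2) Σ_{i+j=k, i,j≥1} {S_i, S_j}`.
If `δ₀ S_k = −(1/k!) T_k` for `2 ≤ k ≤ n`, then `δ₀ T_{n+1} = 0` (and `δ₀ T_k = 0` for all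
`2 ≤ k ≤ n + 1`). -/
theorem delta_T_closed (half : R) (hhalf : 2 * half = 1)
    (𝒜 : OddGradedLieModule R A)
    (n : ℕ) (hn : 2 ≤ n)
    (S : ℕ → A) (hSmem : ∀ k : ℕ, 1 ≤ k → k ≤ n → S k ∈ 𝒜.grading 0)
    (hdS₁ : 𝒜.δ₀ (S 1) = 0)
    (T : ℕ → A)
    (hT : ∀ k : ℕ, T k =
      (k.factorial : R) • half • ∑ i ∈ Finset.Ico 1 k, 𝒜.br (S i) (S (k - i)))
    -- `δ₀ S_k = −(1/k!) T_k`, i.e. `δ₀ S_k = −(1/2) Σ_{i+j=k, i,j≥1} {S_i, S_j}`: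
    (hdS : ∀ k : ℕ, 2 ≤ k → k ≤ n →
      𝒜.δ₀ (S k) = -(half • ∑ i ∈ Finset.Ico 1 k, 𝒜.br (S i) (S (k - i)))) :
    𝒜.δ₀ (T (n + 1)) = 0 ∧ ∀ k : ℕ, 2 ≤ k → k ≤ n + 1 → 𝒜.δ₀ (T k) = 0 := by
  have hclosed : ∀ k : ℕ, 2 ≤ k → k ≤ n + 1 → 𝒜.δ₀ (T k) = 0 := by
    intro k hk hkn
    have hS : ∀ i, 1 ≤ i → i < k → S i ∈ 𝒜.grading 0 := fun i h1 hi =>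
      hSmem i h1 (by omega)
    have hδS : ∀ i, 1 ≤ i → i < k →
        𝒜.δ₀ (S i) = -(half • ∑ a ∈ Finset.Ico 1 i, 𝒜.br (S a) (S (i - a))) := by
      intro i h1 hi
      obtain rfl | h2 := h1.eq_or_lt
      · simpa using hdS₁
      · exact hdS i h2 (by omega)
    rw [hT, map_smul, map_smul, 𝒜.δ₀_sum_br half hhalf S k hS hδS]
    obtain rfl | h3 := hk.eq_or_lt
    · simp
    -- The Jacobi identity only kills three times the sum, but `3 ∣ k!`.
    · obtain ⟨m, hm⟩ := Nat.dvd_factorial (by norm_num : 0 < 3) h3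
      rw [smul_comm, Nat.cast_smul_eq_nsmul, hm, mul_comm, mul_nsmul',
        𝒜.three_nsmul_sum_br_br_eq_zero S k hS, smul_zero, smul_zero]
  exact ⟨hclosed (n + 1) (by omega) le_rfl, hclosed⟩

end BVBRST
end

section
/- Suppose Δ ∘ Δ = 0 and S̃ ∈ A₀ satisfies the classical master equation {S̃, S̃} = 0. Then Δ S̃ is closed for the operator {S̃, ·}: {S̃, Δ S̃} = 0. -/
namespace BVAlg

variable {R A : Type*} [CommRing R] [Ring A] [Algebra R A]

/-- If `Δ ∘ Δ = 0` and `S̃ ∈ A₀` satisfies the classical master equation `{S̃, S̃} = 0`,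
then `Δ S̃` is closed for the operator `{S̃, ·}`: `{S̃, Δ S̃} = 0`. -/
theorem delta_S_closed (𝒜 : ℤ → Submodule R A) [GradedAlgebra 𝒜]
    (h2 : IsUnit (2 : R))
    (hcomm : ∀ (i j : ℤ) (f g : A), f ∈ 𝒜 i → g ∈ 𝒜 j → f * g = gsign (i * j) (g * f))
    (Δ : A →ₗ[R] A) (hΔ : ∀ i : ℤ, ∀ f ∈ 𝒜 i, Δ f ∈ 𝒜 (i + 1))
    (hΔ2 : Δ ∘ₗ Δ = 0)
    (S : A) (hS : S ∈ 𝒜 0) (hCME : dbracket Δ 0 S S = 0) :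
    dbracket Δ 0 S (Δ S) = 0 := by
  have hD : Δ S ∈ 𝒜 1 := by simpa using hΔ 0 S hS
  have hΔΔ : ∀ x, Δ (Δ x) = 0 := fun x => by simpa using LinearMap.congr_fun hΔ2 x
  have two_torsion_free : ∀ x : A, x + x = 0 → x = 0 := fun x hx =>
    (h2.smul_eq_zero).mp (by rw [two_smul, hx])
  have hcommS : Δ S * S = S * Δ S := by simpa [gsign] using hcomm 1 0 _ _ hD hS
  have hsq : Δ S * Δ S = 0 := two_torsion_free _ <| by
    have h := hcomm 1 1 _ _ hD hD
    simp only [gsign, mul_one, Int.not_even_one, if_false] at h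
    exact eq_neg_iff_add_eq_zero.mp h
  have hΔSS : Δ (S * S) = S * Δ S + S * Δ S := by
    simp only [dbracket, gsign, Even.zero, if_true, hcommS] at hCME
    rwa [sub_sub, sub_eq_zero] at hCME
  have hΔSD : Δ (S * Δ S) = 0 := two_torsion_free _ <| by
    rw [← map_add, ← hΔSS, hΔΔ]
  simp [dbracket, gsign, hΔΔ, hsq, hΔSD]

end BVAlg
end
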